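/- Let L be an n×n real symmetric matrix whose kernel is exactly span(1), let λ̃ be an eigenvalue of L with L̃ = L − λ̃ Iₙ having kernel exactly span(ṽ) for a nonzero ṽ, assume every column of L̃ is nonzero, let P = diag(P₁, …, Pₙ) with Pᵢ = (l̃ⁱ (l̃ⁱ)ᵀ)/((l̃ⁱ)ᵀ l̃ⁱ), and let M = k(L ⊗ Iₙ + P) with k > 0, assuming L is positive semidefinite. Then 1 ⊗ ṽ is an equilibrium of the linear system ż = −M z, i.e., M (1 ⊗ ṽ) = 0. -/

import Mathlib

open Matrix Kronecker

/-- Kronecker product of two vectors. -/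
def vKron {m n : ℕ} (v : Fin m → ℝ) (w : Fin n → ℝ) : Fin m × Fin n → ℝ :=
  fun p => v p.1 * w p.2

/-- Rank-one projection `(v vᵀ)/(vᵀ v)`. -/
noncomputable def proj {n : ℕ} (v : Fin n → ℝ) : Matrix (Fin n) (Fin n) ℝ :=
  (v ⬝ᵥ v)⁻¹ • Matrix.vecMulVec v v

/-- `n²×n²` block-diagonal matrix with blocks `P 1, …, P n`. -/
def bdiag {n : ℕ} (P : Fin n → Matrix (Fin n) (Fin n) ℝ) :
    Matrix (Fin n × Fin n) (Fin n × Fin n) ℝ :=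
  fun p q => if p.1 = q.1 then P p.1 p.2 q.2 else 0

theorem kronecker_mulVec_vKron {m n : ℕ} (A : Matrix (Fin m) (Fin m) ℝ)
    (B : Matrix (Fin n) (Fin n) ℝ) (v : Fin m → ℝ) (w : Fin n → ℝ) :
    (A ⊗ₖ B) *ᵥ vKron v w = vKron (A *ᵥ v) (B *ᵥ w) := by
  ext p
  simp only [mulVec, dotProduct, vKron, kroneckerMap_apply, Fintype.sum_prod_type,
    Finset.sum_mul_sum]
  exact Finset.sum_congr rfl fun i _ => Finset.sum_congr rfl fun j _ => by ring

theorem bdiag_mulVec_apply {n : ℕ} (P : Fin n → Matrix (Fin n) (Fin n) ℝ)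
    (x : Fin n × Fin n → ℝ) (p : Fin n × Fin n) :
    (bdiag P *ᵥ x) p = (P p.1 *ᵥ fun j => x (p.1, j)) p.2 := by
  simp [mulVec, dotProduct, bdiag, Fintype.sum_prod_type, ite_mul, Finset.sum_ite_irrel]

theorem proj_mulVec_eq_zero {n : ℕ} {v w : Fin n → ℝ} (h : v ⬝ᵥ w = 0) :
    proj v *ᵥ w = 0 := by
  simp [proj, smul_mulVec, vecMulVec_mulVec, h]

/-- Under the hypotheses of the eigenvector-estimator construction
(`L` symmetric PSD with `ker L = span(1)`, `λ̃` an eigenvalue, `L̃ = L − λ̃ Iₙ` with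
`ker L̃ = span(ṽ)` and nonzero columns, `P = diag(P₁,…,Pₙ)`, `M = k(L ⊗ Iₙ + P)`,
`k > 0`), the vector `1 ⊗ ṽ` is an equilibrium of `ż = −M z`: `M (1 ⊗ ṽ) = 0`. -/
theorem stmt19 (n : ℕ) (L : Matrix (Fin n) (Fin n) ℝ)
    (hpsd : L.PosSemidef)
    (hkerL : ∀ x : Fin n → ℝ, L *ᵥ x = 0 ↔ ∃ c : ℝ, x = c • (fun _ => (1 : ℝ)))
    (lam : ℝ) (tv : Fin n → ℝ) (htv : tv ≠ 0)
    (heig : L *ᵥ tv = lam • tv)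
    (Lt : Matrix (Fin n) (Fin n) ℝ)
    (hLt : Lt = L - lam • (1 : Matrix (Fin n) (Fin n) ℝ))
    (hkerLt : ∀ x : Fin n → ℝ, Lt *ᵥ x = 0 ↔ ∃ c : ℝ, x = c • tv)
    (hcol : ∀ i, (fun j => Lt j i) ≠ 0)
    (P : Matrix (Fin n × Fin n) (Fin n × Fin n) ℝ)
    (hP : P = bdiag (fun i => proj (fun j => Lt j i)))
    (k : ℝ) (hk : 0 < k)
    (M : Matrix (Fin n × Fin n) (Fin n × Fin n) ℝ)
    (hM : M = k • ((L ⊗ₖ (1 : Matrix (Fin n) (Fin n) ℝ)) + P)) :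
    M *ᵥ vKron (fun _ => (1 : ℝ)) tv = 0 := by
  have hL : L *ᵥ (fun _ => (1 : ℝ)) = 0 := (hkerL _).2 ⟨1, (one_smul ℝ _).symm⟩
  have hLt_tv : Lt *ᵥ tv = 0 := (hkerLt tv).2 ⟨1, (one_smul ℝ tv).symm⟩
  have hsymm : Ltᵀ = Lt := by
    have hLsymm : Lᵀ = L := by
      simpa only [conjTranspose_eq_transpose_of_trivial] using hpsd.isHermitian.eq
    rw [hLt, transpose_sub, transpose_smul, transpose_one, hLsymm]
  have hortho (i : Fin n) : (fun j => Lt j i) ⬝ᵥ tv = 0 := by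
    have h := congrFun hLt_tv i
    rw [← hsymm] at h
    exact h
  have hPz : P *ᵥ vKron (fun _ => (1 : ℝ)) tv = 0 := by
    ext p
    have hblock : (fun j => vKron (fun _ : Fin n => (1 : ℝ)) tv (p.1, j)) = tv := by
      ext j
      simp [vKron]
    rw [hP, bdiag_mulVec_apply, hblock, proj_mulVec_eq_zero (hortho p.1)]
    rfl
  have hLz : (L ⊗ₖ (1 : Matrix (Fin n) (Fin n) ℝ)) *ᵥ vKron (fun _ => (1 : ℝ)) tv = 0 := by
    rw [kronecker_mulVec_vKron, hL]
    ext p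
    simp [vKron]
  rw [hM, smul_mulVec, add_mulVec, hLz, hPz, add_zero, smul_zero]
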